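/- Suppose {α_n} and {α_n′} (n ∈ ℕ) are sequences of Cantor paths in a metric space (X,d), γ : [0,1] → X is a path, and {f_n} is a sequence of increasing homeomorphisms f_n : [0,1] → [0,1] such that: (1) {α_n} converges uniformly to γ; (2) α_n ⪯* α_n′ for all n; (3) α_{n+1} = α_n′ ∘ f_n for all n; (4) there exist a > 0 and r with 0 ≤ r < 1 such that sup_{t} |f_n(t) − t| ≤ a·rⁿ for all n. Then α_n ≃ᵣ γ for all n ∈ ℕ. -/

import Mathlib

open Set Filter Topology

noncomputable section

/-- An ℝ-tree: a nonempty geodesic, uniquely arcwise connected, locally arcwise connected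
metric space. -/
structure IsRTree (T : Type) [MetricSpace T] : Prop where
  nonempty : Nonempty T
  geodesic : ∀ x y : T, ∃ γ : ℝ → T, γ 0 = x ∧ γ (dist x y) = y ∧
    ∀ s ∈ Set.Icc (0:ℝ) (dist x y), ∀ t ∈ Set.Icc (0:ℝ) (dist x y),
      dist (γ s) (γ t) = |s - t|
  uniquelyArcwise : ∀ p q : unitInterval → T, Continuous p → Continuous q →
    Function.Injective p → Function.Injective q → p 0 = q 0 → p 1 = q 1 →
    Set.range p = Set.range q
  locallyArcwise : LocPathConnectedSpace T

/-- `β` is a geodesic ℝ-tree reduction of `α`, i.e. `α ≥ᵣ β`. -/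
def GeodesicReduction {X : Type*} [TopologicalSpace X] (α β : unitInterval → X) : Prop :=
  ∃ (T : Type) (_ : MetricSpace T), IsRTree T ∧
    ∃ (f : T → X) (p r : unitInterval → T),
      Continuous f ∧ Continuous p ∧ Continuous r ∧ Function.Injective r ∧
      r 0 = p 0 ∧ r 1 = p 1 ∧ f ∘ p = α ∧ f ∘ r = β

/-- The concatenation of `α` with the reverse of `β`: `α` on `[0,1/2]`, reverse of `β`
on `[1/2,1]`. -/
def ConcatReverse {X : Type*} (α β : unitInterval → X) : unitInterval → X :=
  fun t => if (t : ℝ) ≤ 1 / 2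
    then α (Set.projIcc (0:ℝ) 1 zero_le_one (2 * (t : ℝ)))
    else β (Set.projIcc (0:ℝ) 1 zero_le_one (2 - 2 * (t : ℝ)))

/-- The standard concatenation `α·β`: `α` on `[0,1/2]`, `β` on `[1/2,1]`. -/
def PathConcat {X : Type*} (α β : unitInterval → X) : unitInterval → X :=
  fun t => if (t : ℝ) ≤ 1 / 2
    then α (Set.projIcc (0:ℝ) 1 zero_le_one (2 * (t : ℝ)))
    else β (Set.projIcc (0:ℝ) 1 zero_le_one (2 * (t : ℝ) - 1))

/-- `α ≃ᵣ β`: the loop `α·(reverse β)` factors through an ℝ-tree. -/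
def RTreeHomotopic {X : Type*} [TopologicalSpace X] (α β : unitInterval → X) : Prop :=
  α 0 = β 0 ∧ α 1 = β 1 ∧
  ∃ (T : Type) (_ : MetricSpace T), IsRTree T ∧
    ∃ (f : T → X) (ℓ : unitInterval → T),
      Continuous f ∧ Continuous ℓ ∧ ℓ 0 = ℓ 1 ∧ f ∘ ℓ = ConcatReverse α β

/-- `α ≡ β`: equality up to an increasing self-homeomorphism of `[0,1]`. -/
def PathEquiv {X : Type*} (α β : unitInterval → X) : Prop :=
  ∃ h : unitInterval ≃ₜ unitInterval, StrictMono (⇑h) ∧ α = β ∘ ⇑h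

/-- Fréchet equivalence of paths. -/
def FrechetEquiv {X : Type*} (α β : unitInterval → X) : Prop :=
  ∃ f g : unitInterval → unitInterval,
    Continuous f ∧ Continuous g ∧ Monotone f ∧ Monotone g ∧
    Function.Surjective f ∧ Function.Surjective g ∧ α ∘ f = β ∘ g

/-- `p` lifts all paths uniquely rel. starting point. -/
def LiftsPathsUniquely {E X : Type*} [TopologicalSpace E] [TopologicalSpace X]
    (p : E → X) : Prop :=
  ∀ α : unitInterval → X, Continuous α → ∀ e : E, p e = α 0 →
    ∃! αl : unitInterval → E, Continuous αl ∧ αl 0 = e ∧ p ∘ αl = α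

/-- An open `U ⊆ (0,1)` is a Cantor complement if `[0,1] \ U` is homeomorphic to the
Cantor set. -/
def IsCantorComplement (U : Set ℝ) : Prop :=
  IsOpen U ∧ U ⊆ Set.Ioo 0 1 ∧ Nonempty (↥(Set.Icc (0:ℝ) 1 \ U) ≃ₜ (ℕ → Bool))

/-- `𝒪(α)`: the set of points of `[0,1]` (as reals) at which `α` is locally constant. -/
def Oset {X : Type*} [TopologicalSpace X] (α : unitInterval → X) : Set ℝ :=
  {x | ∃ hx : x ∈ unitInterval,
    ∃ U ∈ nhds (⟨x, hx⟩ : unitInterval), ∀ s ∈ U, α s = α ⟨x, hx⟩}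

/-- A Cantor path: a non-constant path whose locally-constant set is a Cantor complement. -/
def IsCantorPath {X : Type*} [TopologicalSpace X] (α : unitInterval → X) : Prop :=
  Continuous α ∧ (∃ s t, α s ≠ α t) ∧ IsCantorComplement (Oset α)

/-- Two Cantor paths are staggered if their locally-constant sets cover `(0,1)`. -/
def StaggeredPaths {X : Type*} [TopologicalSpace X] (α β : unitInterval → X) : Prop :=
  Oset α ∪ Oset β = Set.Ioo 0 1

/-- The restriction of `β` to `[a,b]`, linearly reparameterized on `[0,1]`. -/
def restrictIcc {X : Type*} (β : unitInterval → X) (a b : ℝ) : unitInterval → X :=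
  fun t => β (Set.projIcc (0:ℝ) 1 zero_le_one (a + (b - a) * (t : ℝ)))

/-- A Cantor-inverse-pair loop (CIP-loop). -/
def IsCIPLoop {X : Type*} [TopologicalSpace X] (ℓ : unitInterval → X) : Prop :=
  ∃ (α : unitInterval → X) (h : unitInterval ≃ₜ unitInterval), StrictMono (⇑h) ∧
    ℓ ∘ ⇑h = ConcatReverse α α ∧
    (IsCantorPath α ∨
      ∃ (α₁ : unitInterval → X) (x : X) (h' : unitInterval ≃ₜ unitInterval),
        StrictMono (⇑h') ∧ IsCantorPath α₁ ∧ α ∘ ⇑h' = PathConcat α₁ (fun _ => x))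

/-- `β` is a `𝒰`-extension of `α` for `𝒰` a set of connected components of `𝒪(α)`. -/
def UExtension {X : Type*} [TopologicalSpace X] (α β : unitInterval → X)
    (𝒰 : Set (Set ℝ)) : Prop :=
  (∀ J ∈ 𝒰, ∃ x ∈ Oset α, J = connectedComponentIn (Oset α) x) ∧
  (∀ t : unitInterval, (t : ℝ) ∉ ⋃₀ 𝒰 → β t = α t) ∧
  (∀ J ∈ 𝒰, IsCIPLoop (restrictIcc β (sInf J) (sSup J)))

/-- `α ⪯* β`: `β` is a `𝒰`-extension of `α` for some `𝒰 ⊆ lc(α)`. -/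
def PrecExt {X : Type*} [TopologicalSpace X] (α β : unitInterval → X) : Prop :=
  ∃ 𝒰 : Set (Set ℝ), UExtension α β 𝒰

/-- The sup-metric `ρ` on paths into a metric space. -/
def pathDist {X : Type*} [PseudoMetricSpace X] (α β : unitInterval → X) : ℝ :=
  ⨆ t : unitInterval, dist (α t) (β t)

/-- The image of a set `U ⊆ [0,1] ⊆ ℝ` under a self-homeomorphism of `[0,1]`. -/
def imageOnIcc (f : unitInterval ≃ₜ unitInterval) (U : Set ℝ) : Set ℝ :=
  Subtype.val '' (⇑f '' (Subtype.val ⁻¹' U))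

/-- The Euclidean half-space of dimension `n` (all of `ℝ⁰` when `n = 0`). -/
def halfSpace (n : ℕ) : Set (EuclideanSpace ℝ (Fin n)) :=
  {y | ∀ i : Fin n, (i : ℕ) = 0 → 0 ≤ y i}

/-- A topological manifold with (possibly empty) boundary: second countable, Hausdorff,
locally homeomorphic to open subsets of Euclidean half-spaces. -/
def IsTopManifold (M : Type*) [TopologicalSpace M] : Prop :=
  SecondCountableTopology M ∧ T2Space M ∧
  ∀ x : M, ∃ (n : ℕ) (U : Set M) (V : Set (halfSpace n)),
    U ∈ nhds x ∧ IsOpen V ∧ Nonempty (↥U ≃ₜ ↥V)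

/-- The closed unit disk in the Euclidean plane. -/
abbrev Disk2 : Type := ↥(Metric.closedBall (0 : EuclideanSpace ℝ (Fin 2)) 1)

end

open scoped unitInterval

/-! ### ℝ-trees from the four-point condition -/

/-- The four-point (0-hyperbolicity) inequality. -/
def FourPoint (T : Type*) [PseudoMetricSpace T] : Prop :=
  ∀ x y z w : T, dist x y + dist z w ≤ max (dist x z + dist y w) (dist x w + dist y z)

/-- Every pair of points can be interpolated metrically. -/
def SegmentsExist (T : Type*) [PseudoMetricSpace T] : Prop :=
  ∀ (x y : T) (τ : ℝ), 0 ≤ τ → τ ≤ dist x y → ∃ z, dist x z = τ ∧ dist z y = dist x y - τ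

section FourPoint

variable {T : Type} [MetricSpace T]

theorem FourPoint.dist_eq_of_mem_segment (h4 : FourPoint T) {x y z w : T}
    (hz : dist x z + dist z y = dist x y) (hw : dist x w + dist w y = dist x y) :
    dist z w = |dist x z - dist x w| := by
  have h := h4 x y z w
  have h1 := dist_triangle x z w
  have h2 := dist_triangle x w z
  rw [dist_comm w z] at h2
  rw [dist_comm y w, dist_comm y z] at h
  apply le_antisymm
  · rcases le_max_iff.1 h with h | h
    · exact le_trans (by linarith) (le_abs_self _)
    · exact le_trans (by linarith) (neg_le_abs _)
  · rw [abs_le]; constructor <;> linarith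

theorem FourPoint.exists_geodesic (h4 : FourPoint T) (hs : SegmentsExist T) (x y : T) :
    ∃ γ : ℝ → T, γ 0 = x ∧ γ (dist x y) = y ∧
      ∀ s ∈ Icc (0 : ℝ) (dist x y), ∀ t ∈ Icc (0 : ℝ) (dist x y),
        dist (γ s) (γ t) = |s - t| := by
  have : ∀ τ : ℝ, ∃ z, τ ∈ Icc (0 : ℝ) (dist x y) →
      dist x z = τ ∧ dist z y = dist x y - τ := by
    intro τ
    by_cases hτ : τ ∈ Icc (0 : ℝ) (dist x y)
    · obtain ⟨z, hz⟩ := hs x y τ hτ.1 hτ.2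
      exact ⟨z, fun _ => hz⟩
    · exact ⟨x, fun h => absurd h hτ⟩
  choose γ hγ using this
  refine ⟨γ, ?_, ?_, ?_⟩
  · exact (dist_eq_zero.1 (hγ 0 ⟨le_rfl, dist_nonneg⟩).1).symm
  · have := (hγ (dist x y) ⟨dist_nonneg, le_rfl⟩).2
    rw [sub_self] at this
    exact dist_eq_zero.1 this
  · intro s hs t ht
    obtain ⟨a, b⟩ := hγ s hs
    obtain ⟨c, d⟩ := hγ t ht
    rw [h4.dist_eq_of_mem_segment (x := x) (y := y) (by linarith) (by linarith), a, c]

/-- A connected set containing the endpoints of a segment contains the segment. -/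
theorem FourPoint.mem_of_isPreconnected (h4 : FourPoint T) {x y z : T} {S : Set T}
    (hS : IsPreconnected S) (hx : x ∈ S) (hy : y ∈ S)
    (hz : dist x z + dist z y = dist x y) : z ∈ S := by
  by_contra hzS
  have hxz : 0 < dist x z := dist_pos.2 fun h => hzS (h ▸ hx)
  have hyz : 0 < dist z y := dist_pos.2 fun h => hzS (h ▸ hy)
  let U : Set T := {w | dist x w < dist x z + dist z w}
  let V : Set T := {w | dist x z + dist z w ≤ dist x w ∧ 0 < dist z w}
  have hU : IsOpen U := isOpen_lt (by fun_prop) (by fun_prop)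
  have hV : IsOpen V := by
    rw [Metric.isOpen_iff]
    rintro w ⟨hw1, hw2⟩
    refine ⟨dist z w, hw2, fun v hv => ?_⟩
    rw [Metric.mem_ball] at hv
    have hzv : 0 < dist z v := by linarith [dist_triangle z v w]
    refine ⟨?_, hzv⟩
    have := h4 x w v z
    rw [dist_comm v z, dist_comm w v, dist_comm w z] at this
    rcases le_max_iff.1 this with h | h
    · linarith
    · linarith
  have hd : Disjoint U V := by
    rw [Set.disjoint_left]
    intro w h1 h2
    exact absurd h1 (not_lt.2 h2.1)
  have hsub : S ⊆ U ∪ V := by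
    intro w hw
    by_cases h : w ∈ U
    · exact Or.inl h
    · exact Or.inr ⟨not_lt.1 h, dist_pos.2 fun h => hzS (h ▸ hw)⟩
  have hxU : x ∈ U := by
    change dist x x < dist x z + dist z x
    rw [dist_self]; linarith [dist_nonneg (x := z) (y := x)]
  have := hS.subset_left_of_subset_union hU hV hd hsub ⟨x, hx, hxU⟩ hy
  exact absurd this (not_lt.2 hz.le)

theorem FourPoint.exists_median (h4 : FourPoint T) (hs : SegmentsExist T) (x y w : T) :
    ∃ z, dist x z + dist z y = dist x y ∧ dist x z + dist z w = dist x w ∧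
      dist w z + dist z y = dist w y := by
  obtain ⟨z, hz1, hz2⟩ := hs x y ((dist x y + dist x w - dist w y) / 2)
    (by linarith [dist_triangle w x y, dist_comm w x])
    (by linarith [dist_triangle x y w, dist_comm w y])
  have h := h4 x y z w
  have h1 := dist_triangle x z w
  have h2 := dist_triangle w z y
  rw [dist_comm y w, dist_comm y z] at h
  rw [dist_comm w z] at h2
  refine ⟨z, by linarith, ?_, ?_⟩
  · rcases le_max_iff.1 h with h | h <;> linarith
  · rw [dist_comm w z]
    rcases le_max_iff.1 h with h | h <;> linarith

theorem FourPoint.mem_segment_of_arc (h4 : FourPoint T) (hs : SegmentsExist T)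
    {p : I → T} (hp : Continuous p) (hinj : Function.Injective p) (t : I) :
    dist (p 0) (p t) + dist (p t) (p 1) = dist (p 0) (p 1) := by
  obtain ⟨z, h1, h2, h3⟩ := h4.exists_median hs (p 0) (p 1) (p t)
  obtain ⟨a, ha, haz⟩ := h4.mem_of_isPreconnected
    (isPreconnected_Icc.image p hp.continuousOn)
    (mem_image_of_mem p (left_mem_Icc.2 (unitInterval.nonneg' (t := t))))
    (mem_image_of_mem p (right_mem_Icc.2 (unitInterval.nonneg' (t := t)))) h2
  obtain ⟨b, hb, hbz⟩ := h4.mem_of_isPreconnected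
    (isPreconnected_Icc.image p hp.continuousOn)
    (mem_image_of_mem p (left_mem_Icc.2 (unitInterval.le_one' (t := t))))
    (mem_image_of_mem p (right_mem_Icc.2 (unitInterval.le_one' (t := t)))) h3
  have hab : a = b := hinj (haz.trans hbz.symm)
  have : t = a := le_antisymm (hab ▸ hb.1) ha.2
  rw [this, haz]
  exact h1

theorem FourPoint.isRTree (h4 : FourPoint T) (hs : SegmentsExist T) (hne : Nonempty T) :
    IsRTree T where
  nonempty := hne
  geodesic := h4.exists_geodesic hs
  uniquelyArcwise := by
    have key : ∀ p q : I → T, Continuous p → Continuous q →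
        Function.Injective p → p 0 = q 0 → p 1 = q 1 → range p ⊆ range q := by
      rintro p q hp hq hpi h0 h1 _ ⟨t, rfl⟩
      refine h4.mem_of_isPreconnected (isPreconnected_range hq) ⟨0, rfl⟩ ⟨1, rfl⟩ ?_
      rw [← h0, ← h1]
      exact h4.mem_segment_of_arc hs hp hpi t
    intro p q hp hq hpi hqi h0 h1
    exact Subset.antisymm (key p q hp hq hpi h0 h1) (key q p hq hp hqi h0.symm h1.symm)
  locallyArcwise := by
    refine LocallyPathConnectedSpace.of_bases (fun x => Metric.nhds_basis_ball (x := x)) ?_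
    intro x r hr
    refine ⟨x, Metric.mem_ball_self hr, fun {y} hy => ?_⟩
    obtain ⟨γ, h0, h1, hiso⟩ := h4.exists_geodesic hs x y
    have hd : 0 ≤ dist x y := dist_nonneg
    have hcont : ContinuousOn γ (Icc 0 (dist x y)) := by
      rw [Metric.continuousOn_iff]
      intro b hb ε hε
      exact ⟨ε, hε, fun a ha hab => by rwa [hiso a ha b hb]⟩
    have hpath : IsPathConnected (γ '' Icc 0 (dist x y)) :=
      ((convex_Icc 0 (dist x y)).isPathConnected ⟨0, left_mem_Icc.2 hd⟩).image' hcont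
    refine (hpath.joinedIn x ⟨0, left_mem_Icc.2 hd, h0⟩ y ⟨_, right_mem_Icc.2 hd, h1⟩).mono ?_
    rintro _ ⟨s, hs, rfl⟩
    have := hiso s hs 0 (left_mem_Icc.2 hd)
    rw [h0, sub_zero, abs_of_nonneg hs.1] at this
    rw [Metric.mem_ball, this]
    rw [Metric.mem_ball, dist_comm] at hy
    exact lt_of_le_of_lt hs.2 hy

end FourPoint

theorem FourPoint.isRTree_separationQuotient {P : Type} [PseudoMetricSpace P] [Nonempty P]
    (h4 : FourPoint P) (hs : SegmentsExist P) : IsRTree (SeparationQuotient P) := by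
  refine FourPoint.isRTree ?_ ?_ inferInstance
  · intro x y z w
    obtain ⟨x, rfl⟩ := SeparationQuotient.surjective_mk x
    obtain ⟨y, rfl⟩ := SeparationQuotient.surjective_mk y
    obtain ⟨z, rfl⟩ := SeparationQuotient.surjective_mk z
    obtain ⟨w, rfl⟩ := SeparationQuotient.surjective_mk w
    simp only [SeparationQuotient.dist_mk]
    exact h4 _ _ _ _
  · intro x y
    obtain ⟨x, rfl⟩ := SeparationQuotient.surjective_mk x
    obtain ⟨y, rfl⟩ := SeparationQuotient.surjective_mk y
    intro τ h0 h1
    simp only [SeparationQuotient.dist_mk] at h1 ⊢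
    obtain ⟨z, hz⟩ := hs _ _ τ h0 h1
    exact ⟨SeparationQuotient.mk z, hz⟩

/-! ### The tree coded by a height function -/

/-- The minimum of `h` between `s` and `t`. -/
noncomputable def minBetween (h : C(I, ℝ)) (s t : I) : ℝ :=
  sInf ((fun u : I => h (max (min s t) (min u (max s t)))) '' univ)

section MinBetween

variable (h : C(I, ℝ)) (s t u : I)

theorem image_clamp : (fun u : I => max (min s t) (min u (max s t))) '' univ = uIcc s t := by
  ext v
  simp only [image_univ, mem_range, uIcc, mem_Icc]
  constructor
  · rintro ⟨u, rfl⟩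
    exact ⟨le_max_left _ _, max_le inf_le_sup (min_le_right _ _)⟩
  · rintro ⟨h1, h2⟩
    exact ⟨v, by rw [min_eq_left h2, max_eq_right h1]⟩

theorem minBetween_eq : minBetween h s t = sInf (h '' uIcc s t) := by
  rw [← image_clamp, image_image, minBetween]

theorem isLeast_minBetween : IsLeast (h '' uIcc s t) (minBetween h s t) := by
  rw [minBetween_eq]
  exact (isCompact_uIcc.image h.continuous).isLeast_sInf (nonempty_uIcc.image _)

theorem continuous_minBetween : Continuous fun p : I × I => minBetween h p.1 p.2 := by
  unfold minBetween
  refine isCompact_univ.continuous_sInf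
    (f := fun (p : I × I) (u : I) => h (max (min p.1 p.2) (min u (max p.1 p.2)))) ?_
  change Continuous fun q : (I × I) × I => _
  exact h.continuous.comp (by fun_prop)

theorem minBetween_self : minBetween h s s = h s := by simp [minBetween_eq]

theorem minBetween_comm : minBetween h s t = minBetween h t s := by
  rw [minBetween_eq, minBetween_eq, uIcc_comm]

variable {h s t u} in
theorem minBetween_le (hu : u ∈ uIcc s t) : minBetween h s t ≤ h u :=
  (isLeast_minBetween h s t).2 (mem_image_of_mem _ hu)

variable {h s t} in
theorem le_minBetween {c : ℝ} (hc : ∀ u ∈ uIcc s t, c ≤ h u) : c ≤ minBetween h s t := by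
  obtain ⟨v, hv, hv'⟩ := (isLeast_minBetween h s t).1
  exact hv' ▸ hc v hv

theorem minBetween_ultra : min (minBetween h s t) (minBetween h t u) ≤ minBetween h s u := by
  refine le_minBetween fun v hv => ?_
  rcases uIcc_subset_uIcc_union_uIcc (b := t) hv with hv | hv
  · exact (min_le_left _ _).trans (minBetween_le hv)
  · exact (min_le_right _ _).trans (minBetween_le hv)

variable {h s t} in
theorem exists_minBetween_eq {y : ℝ} (h1 : minBetween h s t ≤ y) (h2 : y ≤ h s) :
    ∃ v, h v = y ∧ minBetween h s v = y := by
  have hc : Continuous fun v => minBetween h s v :=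
    (continuous_minBetween h).comp (by fun_prop : Continuous fun v : I => (s, v))
  have := intermediate_value_uIcc (a := s) (b := t) hc.continuousOn
  rw [minBetween_self] at this
  obtain ⟨v, -, hv⟩ := this (mem_uIcc.2 (Or.inr ⟨h1, h2⟩))
  obtain ⟨w, hw, hw'⟩ := (isLeast_minBetween h s v).1
  simp only at hv
  refine ⟨w, hw'.trans hv, le_antisymm ?_ ?_⟩
  · exact (minBetween_le right_mem_uIcc).trans (hw'.trans hv).le
  · rw [← hv]
    exact le_minBetween fun z hz => minBetween_le (uIcc_subset_uIcc left_mem_uIcc hw hz)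

end MinBetween

/-- `[0,1]` with the pseudometric coded by the height function `h`. -/
structure HeightSpace (h : C(I, ℝ)) : Type where
  /-- The underlying parameter. -/
  pt : I

instance (h : C(I, ℝ)) : Nonempty (HeightSpace h) := ⟨⟨0⟩⟩

noncomputable instance (h : C(I, ℝ)) : PseudoMetricSpace (HeightSpace h) where
  dist s t := h s.pt + h t.pt - 2 * minBetween h s.pt t.pt
  dist_self s := by
    rw [minBetween_self]; ring
  dist_comm s t := by
    rw [minBetween_comm]; ring
  dist_triangle s t u := by
    have h1 := minBetween_ultra h s.pt t.pt u.pt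
    have h2 : minBetween h s.pt t.pt ≤ h t.pt := minBetween_le right_mem_uIcc
    have h3 : minBetween h t.pt u.pt ≤ h t.pt := minBetween_le left_mem_uIcc
    rcases min_le_iff.1 h1 with h1 | h1 <;> linarith

theorem HeightSpace.dist_def (h : C(I, ℝ)) (s t : HeightSpace h) :
    dist s t = h s.pt + h t.pt - 2 * minBetween h s.pt t.pt := rfl

theorem HeightSpace.fourPoint (h : C(I, ℝ)) : FourPoint (HeightSpace h) := by
  rintro ⟨x⟩ ⟨y⟩ ⟨z⟩ ⟨w⟩
  simp only [HeightSpace.dist_def]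
  have a1 := minBetween_ultra h x y z
  have a2 := minBetween_ultra h x y w
  have a3 := minBetween_ultra h x z y
  have a4 := minBetween_ultra h x z w
  have a5 := minBetween_ultra h x w y
  have a6 := minBetween_ultra h x w z
  have a7 := minBetween_ultra h y x z
  have a8 := minBetween_ultra h y x w
  have a9 := minBetween_ultra h y z w
  have b1 := minBetween_ultra h y w z
  have b2 := minBetween_ultra h z x w
  have b3 := minBetween_ultra h z y w
  simp only [minBetween_comm h y x, minBetween_comm h z x, minBetween_comm h z y,
    minBetween_comm h w y, minBetween_comm h w z] at *
  grind

theorem HeightSpace.segmentsExist (h : C(I, ℝ)) : SegmentsExist (HeightSpace h) := by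
  have key : ∀ (s t : HeightSpace h) (τ : ℝ), 0 ≤ τ →
      τ ≤ h s.pt - minBetween h s.pt t.pt →
      ∃ v, dist s v = τ ∧ dist v t = dist s t - τ := by
    rintro ⟨s⟩ ⟨t⟩ τ h0 h1
    obtain ⟨v, hv, hv'⟩ := exists_minBetween_eq (h := h) (s := s) (t := t) (y := h s - τ)
      (by linarith) (by linarith)
    refine ⟨⟨v⟩, ?_, ?_⟩
    · simp only [HeightSpace.dist_def]
      rw [hv, hv']; ring
    · have e1 := minBetween_ultra h v s t
      have e2 := minBetween_ultra h s v t
      have e3 : minBetween h v t ≤ h v := minBetween_le left_mem_uIcc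
      rw [minBetween_comm h v s] at e1
      simp only [HeightSpace.dist_def]
      grind
  intro s t τ h0 h1
  by_cases hτ : τ ≤ h s.pt - minBetween h s.pt t.pt
  · exact key s t τ h0 hτ
  · have hd := HeightSpace.dist_def h s t
    obtain ⟨v, hv, hv'⟩ := key t s (dist s t - τ) (by linarith)
      (by rw [minBetween_comm h t.pt s.pt]; linarith)
    refine ⟨v, ?_, ?_⟩
    · rw [dist_comm, hv', dist_comm t s]; ring
    · rw [dist_comm, hv]

/-- A path that is compatible with a height function factors through an ℝ-tree. -/
theorem factors_through_rTree {X : Type*} [TopologicalSpace X] (h : C(I, ℝ)) {L : I → X}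
    (hL : Continuous L) (h01 : h 0 = h 1) (hmin : ∀ u, h 0 ≤ h u)
    (hQ : ∀ s t, h s = h t → (∀ u ∈ uIcc s t, h s ≤ h u) → L s = L t) :
    ∃ (T : Type) (_ : MetricSpace T), IsRTree T ∧
      ∃ (f : T → X) (ℓ : I → T), Continuous f ∧ Continuous ℓ ∧ ℓ 0 = ℓ 1 ∧ f ∘ ℓ = L := by
  let toP : I → HeightSpace h := fun s => ⟨s⟩
  have htoP : Continuous toP := by
    rw [continuous_iff_continuousAt]
    intro s
    refine tendsto_iff_dist_tendsto_zero.2 ?_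
    change Tendsto (fun t : I => h t + h s - 2 * minBetween h t s) (𝓝 s) (𝓝 0)
    have hc : Continuous fun t : I => h t + h s - 2 * minBetween h t s :=
      (h.continuous.add continuous_const).sub (continuous_const.mul
        ((continuous_minBetween h).comp (by fun_prop : Continuous fun t : I => (t, s))))
    have := hc.tendsto s
    rw [minBetween_self] at this
    convert this using 2
    ring
  let ℓ : I → SeparationQuotient (HeightSpace h) := SeparationQuotient.mk ∘ toP
  have hℓ : Continuous ℓ := SeparationQuotient.continuous_mk.comp htoP
  have hsurj : Function.Surjective ℓ := SeparationQuotient.surjective_mk.comp fun s => ⟨s.pt, rfl⟩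
  have hq : IsQuotientMap ℓ := hℓ.isClosedMap.isQuotientMap hℓ hsurj
  have hlift : ∀ s t : HeightSpace h, Inseparable s t → L s.pt = L t.pt := by
    rintro ⟨s⟩ ⟨t⟩ hst
    have h0 := Metric.inseparable_iff.1 hst
    simp only [HeightSpace.dist_def] at h0
    have h1 : minBetween h s t ≤ h s := minBetween_le left_mem_uIcc
    have h2 : minBetween h s t ≤ h t := minBetween_le right_mem_uIcc
    refine hQ s t (by linarith) fun u hu => ?_
    have h3 : minBetween h s t ≤ h u := minBetween_le hu
    linarith
  let F : SeparationQuotient (HeightSpace h) → X := SeparationQuotient.lift (fun s => L s.pt) hlift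
  have hF : F ∘ ℓ = L := rfl
  refine ⟨SeparationQuotient (HeightSpace h), inferInstance,
    (HeightSpace.fourPoint h).isRTree_separationQuotient (HeightSpace.segmentsExist h),
    F, ℓ, hq.continuous_iff.2 (hF ▸ hL), hℓ, ?_, hF⟩
  refine SeparationQuotient.mk_eq_mk.2 (Metric.inseparable_iff.2 ?_)
  change h 0 + h 1 - 2 * minBetween h 0 1 = 0
  have h1 : minBetween h 0 1 ≤ h 0 := minBetween_le left_mem_uIcc
  have h2 : h 0 ≤ minBetween h 0 1 := le_minBetween fun u _ => hmin u
  linarith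

/-! ### Paths, their constancy intervals, and foldings -/

section Folding

variable {X : Type*}

/-- The points at which `β` is locally constant. -/
def locConst (β : I → X) : Set I := {x | ∀ᶠ y in 𝓝 x, β y = β x}

/-- `β` is constant between `s` and `t`. -/
def ConstOn (β : I → X) (s t : I) : Prop := ∀ u ∈ uIcc s t, β u = β s

theorem ConstOn.eq {β : I → X} {s t u v : I} (h : ConstOn β s t) (hu : u ∈ uIcc s t)
    (hv : v ∈ uIcc s t) : β u = β v := (h u hu).trans (h v hv).symm

theorem ConstOn.mono {β : I → X} {s t u v : I} (h : ConstOn β s t) (hu : u ∈ uIcc s t)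
    (hv : v ∈ uIcc s t) : ConstOn β u v :=
  fun _ hw => h.eq (uIcc_subset_uIcc hu hv hw) hu

theorem ConstOn.symm {β : I → X} {s t : I} (h : ConstOn β s t) : ConstOn β t s :=
  h.mono right_mem_uIcc left_mem_uIcc

theorem ConstOn.trans {β : I → X} {s t u : I} (h : ConstOn β s t) (h' : ConstOn β t u) :
    ConstOn β s u := by
  intro v hv
  rcases uIcc_subset_uIcc_union_uIcc (b := t) hv with hv | hv
  · exact h v hv
  · exact (h' v hv).trans (h t right_mem_uIcc)

theorem isOpen_locConst (β : I → X) : IsOpen (locConst β) := by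
  rw [isOpen_iff_mem_nhds]
  intro x hx
  have hx' : ∀ᶠ y in 𝓝 x, β y = β x := hx
  filter_upwards [hx'.eventually_nhds, hx'] with y hy hyx
  exact hy.mono fun z hz => hz.trans hyx.symm

theorem locConst_comp (β : I → X) (e : I ≃ₜ I) : locConst (β ∘ e) = e ⁻¹' locConst β := by
  ext x
  change (∀ᶠ y in 𝓝 x, β (e y) = β (e x)) ↔ ∀ᶠ y in 𝓝 (e x), β y = β (e x)
  rw [← e.map_nhds_eq, eventually_map]

theorem ConstOn.of_comp {β : I → X} {φ : I → I} (hφ : Continuous φ) {s t : I}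
    (h : ConstOn (β ∘ φ) s t) : ConstOn β (φ s) (φ t) := by
  intro u hu
  obtain ⟨v, hv, rfl⟩ := intermediate_value_uIcc hφ.continuousOn hu
  exact h v hv

theorem ConstOn.comp {β : I → X} {φ : I → I} (hφ : Monotone φ) {s t : I}
    (h : ConstOn β (φ s) (φ t)) : ConstOn (β ∘ φ) s t :=
  fun _ hu => h _ (hφ.mapsTo_uIcc hu)

variable [MetricSpace X]

theorem eq_of_isPreconnected_subset_locConst {β : I → X} (hβ : Continuous β) {S : Set I}
    (hS : IsPreconnected S) (hsub : S ⊆ locConst β) {x y : I} (hx : x ∈ S) (hy : y ∈ S) :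
    β y = β x := by
  have hU : IsOpen {z | z ∈ locConst β ∧ β z = β x} := by
    rw [isOpen_iff_mem_nhds]
    rintro z ⟨hz, hzx⟩
    filter_upwards [(isOpen_locConst β).mem_nhds hz, hz] with w hw hwz
    exact ⟨hw, hwz.trans hzx⟩
  have hV : IsOpen {z | β z ≠ β x} := isOpen_ne_fun hβ continuous_const
  refine (hS.subset_left_of_subset_union hU hV ?_ ?_ ⟨x, hx, hsub hx, rfl⟩ hy).2
  · rw [Set.disjoint_left]
    exact fun z hz hz' => hz' hz.2
  · intro z hz
    by_cases h : β z = β x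
    · exact Or.inl ⟨hsub hz, h⟩
    · exact Or.inr h

theorem constOn_or_exists_left {β : I → X} (hβ : Continuous β) (u t : I) :
    ConstOn β u t ∨ ∃ v ∈ uIcc u t, v ∉ locConst β ∧ ConstOn β u v := by
  rcases (uIcc u t \ locConst β).eq_empty_or_nonempty with h | h
  · left
    intro v hv
    exact eq_of_isPreconnected_subset_locConst hβ isPreconnected_uIcc
      (sdiff_eq_empty.1 h) left_mem_uIcc hv
  · right
    obtain ⟨v, ⟨hv, hvO⟩, hmin⟩ := (isCompact_uIcc.diff (isOpen_locConst β)).exists_isMinOn h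
      (f := fun w : I => |(w : ℝ) - u|) (by fun_prop)
    refine ⟨v, hv, hvO, ?_⟩
    rcases eq_or_ne u v with rfl | huv
    · intro w hw
      rw [uIcc_self] at hw
      rw [hw]
    have hclosed : IsClosed {w | β w = β u} := isClosed_eq hβ continuous_const
    have hO : ∀ w ∈ uIcc u v, w ≠ v → w ∈ locConst β := by
      intro w hw hwv
      by_contra hwO
      have h1 : |(v : ℝ) - u| ≤ |(w : ℝ) - u| :=
        hmin ⟨uIcc_subset_uIcc left_mem_uIcc hv hw, hwO⟩
      apply hwv
      rcases mem_uIcc.1 hw with ⟨a, b⟩ | ⟨a, b⟩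
      · have a' : (u : ℝ) ≤ w := a
        have b' : (w : ℝ) ≤ v := b
        rw [abs_of_nonneg (by linarith), abs_of_nonneg (by linarith)] at h1
        exact Subtype.ext (by linarith)
      · have a' : (v : ℝ) ≤ w := a
        have b' : (w : ℝ) ≤ u := b
        rw [abs_of_nonpos (by linarith), abs_of_nonpos (by linarith)] at h1
        exact Subtype.ext (by linarith)
    rcases lt_or_gt_of_ne huv with huv | huv
    · have hsub : Ico u v ⊆ {w | β w = β u} := fun w hw =>
        eq_of_isPreconnected_subset_locConst hβ isPreconnected_Ico
          (fun z hz => hO z (Icc_subset_uIcc ⟨hz.1, hz.2.le⟩) hz.2.ne)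
          (left_mem_Ico.2 huv) hw
      have := closure_minimal hsub hclosed
      rw [closure_Ico huv.ne] at this
      intro w hw
      rw [uIcc_of_le huv.le] at hw
      exact this hw
    · have hsub : Ioc v u ⊆ {w | β w = β u} := fun w hw =>
        eq_of_isPreconnected_subset_locConst hβ isPreconnected_Ioc
          (fun z hz => hO z (Icc_subset_uIcc' ⟨hz.1.le, hz.2⟩) hz.1.ne')
          (right_mem_Ioc.2 huv) hw
      have := closure_minimal hsub hclosed
      rw [closure_Ioc huv.ne] at this
      intro w hw
      rw [uIcc_of_ge huv.le] at hw
      exact this hw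

/-- Either `β` is constant between `s` and `t`, or every point between them can be moved, along
an interval of constancy, to a point where `β` is not locally constant. -/
theorem constOn_or_exists {β : I → X} (hβ : Continuous β) {s t u : I} (hu : u ∈ uIcc s t) :
    ConstOn β s t ∨ ∃ v ∈ uIcc s t, v ∉ locConst β ∧ ConstOn β u v := by
  rcases constOn_or_exists_left hβ u s with h1 | ⟨v, hv, h⟩
  · rcases constOn_or_exists_left hβ u t with h2 | ⟨v, hv, h⟩
    · exact Or.inl (h1.symm.trans h2)
    · exact Or.inr ⟨v, uIcc_subset_uIcc hu right_mem_uIcc hv, h⟩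
  · exact Or.inr ⟨v, uIcc_subset_uIcc hu left_mem_uIcc hv, h⟩

/-- If `β'` agrees with `β` wherever `β` is not locally constant, then `β` is constant wherever
`β'` is. -/
theorem ConstOn.of_eqOn {β β' : I → X} (hβ : Continuous β)
    (h : ∀ t, t ∉ locConst β → β' t = β t) {s t : I} (hc : ConstOn β' s t) :
    ConstOn β s t := by
  by_contra hn
  have key : ∀ u ∈ uIcc s t, β u = β' s := by
    intro u hu
    rcases constOn_or_exists hβ hu with h1 | ⟨v, hv, hvO, huv⟩
    · exact absurd h1 hn
    · rw [← huv v right_mem_uIcc, ← h v hvO, hc v hv]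
  exact hn fun u hu => (key u hu).trans (key s left_mem_uIcc).symm

/-- `g` is constant along the intervals of constancy of `β`. -/
def HeightConst (g : I → ℝ) (β : I → X) : Prop := ∀ s t, ConstOn β s t → g s = g t

/-- `β` factors through the tree coded by `g`. -/
def HeightCompat (g : I → ℝ) (β : I → X) : Prop :=
  ∀ s t, g s = g t → (∀ u ∈ uIcc s t, g s ≤ g u) → β s = β t

/-- If `h ≥ H` with equality wherever `β` is not locally constant, then a pair identified by `h`
is identified by `H`. -/
theorem HeightConst.min_of_le {β : I → X} (hβ : Continuous β) {H h : I → ℝ}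
    (hH : HeightConst H β) (hle : ∀ t, H t ≤ h t) (heq : ∀ t, t ∉ locConst β → h t = H t)
    {s t : I} (hst : h s = h t) (hmin : ∀ u ∈ uIcc s t, h s ≤ h u) :
    (H s = H t ∧ ∀ u ∈ uIcc s t, H s ≤ H u) ∧ (ConstOn β s t ∨ h s = H s ∧ h t = H t) := by
  by_cases hc : ConstOn β s t
  · exact ⟨⟨hH s t hc, fun u hu => (hH s u (hc.mono left_mem_uIcc hu)).le⟩, Or.inl hc⟩
  have key : ∀ u ∈ uIcc s t, h s ≤ H u := by
    intro u hu
    rcases constOn_or_exists hβ hu with h1 | ⟨v, hv, hvO, huv⟩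
    · exact absurd h1 hc
    · rw [hH u v huv, ← heq v hvO]
      exact hmin v hv
  have h1 : h s = H s := le_antisymm (key s left_mem_uIcc) (hle s)
  have h2 : h t = H t := le_antisymm (hst ▸ key t right_mem_uIcc) (hle t)
  exact ⟨⟨by rw [← h1, ← h2, hst], fun u hu => h1 ▸ key u hu⟩, Or.inr ⟨h1, h2⟩⟩

/-- `β'` arises from `β` by folding intervals of constancy, and `g` is a height function for the
folds. -/
structure IsFolding (β β' : I → X) (g : I → ℝ) : Prop where
  continuous : Continuous g
  nonneg : ∀ t, 0 ≤ g t
  height_eq_zero : ∀ t, t ∉ locConst β → g t = 0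
  eq_of_notMem : ∀ t, t ∉ locConst β → β' t = β t
  eq_of_height_eq : ∀ s t, ConstOn β s t → g s = g t → β' s = β' t
  height_eq_of_constOn : ∀ s t, ConstOn β s t → ConstOn β' s t → g s = g t

namespace IsFolding

variable {β β' : I → X} {g H : I → ℝ}

theorem locConst_subset (hβ : Continuous β) (hg : IsFolding β β' g) :
    locConst β' ⊆ locConst β := by
  intro x hx
  obtain ⟨a, b, hmem, hnhds, hsub⟩ := exists_Icc_mem_subset_of_mem_nhds hx
  have hc' : ConstOn β' a b := by
    have hab := hmem.1.trans hmem.2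
    intro u hu
    rw [uIcc_of_le hab] at hu
    exact (hsub hu : β' u = β' x).trans (hsub (left_mem_Icc.2 hab) : β' a = β' x).symm
  have hc := hc'.of_eqOn hβ hg.eq_of_notMem
  filter_upwards [hnhds] with y hy
  exact hc.eq (Icc_subset_uIcc hy) (Icc_subset_uIcc hmem)

theorem eq_of_height_eq_zero (hβ : Continuous β) (h0 : 0 ∉ locConst β)
    (hg : IsFolding β β' g) {t : I} (ht : g t = 0) : β' t = β t := by
  have key : ∀ v, v ∉ locConst β → ConstOn β t v → β' t = β t := by
    intro v hv hc
    rw [hg.eq_of_height_eq t v hc (ht.trans (hg.height_eq_zero v hv).symm),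
      hg.eq_of_notMem v hv, hc v right_mem_uIcc]
  rcases constOn_or_exists_left hβ t 0 with h | ⟨v, -, hv, hc⟩
  · exact key 0 h0 h
  · exact key v hv hc

theorem heightConst (hβ : Continuous β) (hg : IsFolding β β' g) (hH : HeightConst H β) :
    HeightConst (fun t => H t + g t) β' := by
  intro s t hc
  have hc' := hc.of_eqOn hβ hg.eq_of_notMem
  change H s + g s = H t + g t
  rw [hH s t hc', hg.height_eq_of_constOn s t hc' hc]

theorem heightCompat (hβ : Continuous β) (h0 : 0 ∉ locConst β) (hg : IsFolding β β' g)
    (hH : HeightConst H β) (hQ : HeightCompat H β) :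
    HeightCompat (fun t => H t + g t) β' := by
  intro s t hst hmin
  obtain ⟨⟨h1, h2⟩, h3⟩ := hH.min_of_le hβ (h := fun t => H t + g t)
    (fun t => le_add_of_nonneg_right (hg.nonneg t))
    (fun t ht => by simp only [hg.height_eq_zero t ht, add_zero]) hst hmin
  rcases h3 with h3 | ⟨h3, h4⟩
  · exact hg.eq_of_height_eq s t h3 (by linarith)
  · rw [hg.eq_of_height_eq_zero hβ h0 (by linarith),
      hg.eq_of_height_eq_zero hβ h0 (t := t) (by linarith), hQ s t h1 h2]

end IsFolding

/-- The height function of a convergent sequence of foldings. -/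
theorem exists_height_of_foldings {β : ℕ → I → X} (hβ : ∀ n, Continuous (β n))
    {g : ℕ → I → ℝ} (hg : ∀ n, IsFolding (β n) (β (n + 1)) (g n))
    (hb : ∀ n t, g n t ≤ (1 / 2) ^ n) {δ : I → X}
    (hδ : ∀ t, Tendsto (fun n => β n t) atTop (𝓝 (δ t))) (h0 : 0 ∉ locConst (β 0))
    {H : I → ℝ} (hH : Continuous H) (hHconst : HeightConst H (β 0))
    (hHcompat : HeightCompat H (β 0)) :
    ∃ h : I → ℝ, Continuous h ∧ HeightConst h δ ∧ HeightCompat h δ ∧ (∀ t, H t ≤ h t) ∧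
      (∀ t, t ∉ locConst (β 0) → h t = H t) ∧ ∀ t, h t = H t → δ t = β 0 t := by
  have hsum : Summable fun n : ℕ => (1 / 2 : ℝ) ^ n :=
    summable_geometric_of_lt_one (by norm_num) (by norm_num)
  have hsg : ∀ t, Summable fun n => g n t := fun t =>
    hsum.of_nonneg_of_le (fun n => (hg n).nonneg t) (fun n => hb n t)
  let K : ℕ → I → ℝ := fun n t => H t + ∑ i ∈ Finset.range n, g i t
  let h : I → ℝ := fun t => H t + ∑' i, g i t
  have hKs : ∀ n, K (n + 1) = fun t => K n t + g n t := by
    intro n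
    funext t
    simp only [K, Finset.sum_range_succ, add_assoc]
  have hK0 : K 0 = H := by
    funext t
    simp [K]
  have hmono : ∀ m n, n ≤ m → locConst (β m) ⊆ locConst (β n) := fun m n hnm =>
    antitone_nat_of_succ_le (f := fun n => locConst (β n))
      (fun n => (hg n).locConst_subset (hβ n)) hnm
  have hO : ∀ n, 0 ∉ locConst (β n) := fun n hn => h0 (hmono n 0 n.zero_le hn)
  have hKP : ∀ n, HeightConst (K n) (β n) := by
    intro n
    induction n with
    | zero => rwa [hK0]
    | succ n ih => rw [hKs]; exact (hg n).heightConst (hβ n) ih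
  have hKQ : ∀ n, HeightCompat (K n) (β n) := by
    intro n
    induction n with
    | zero => rwa [hK0]
    | succ n ih => rw [hKs]; exact (hg n).heightCompat (hβ n) (hO n) (hKP n) ih
  have hle : ∀ n t, K n t ≤ h t := fun n t =>
    add_le_add le_rfl ((hsg t).sum_le_tsum _ fun i _ => (hg i).nonneg t)
  have heq : ∀ n t, t ∉ locConst (β n) → h t = K n t := by
    intro n t ht
    have : ∑' i, g i t = ∑ i ∈ Finset.range n, g i t := tsum_eq_sum fun m hm =>
      (hg m).height_eq_zero t fun htm => ht (hmono m n (by simpa using hm) htm)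
    simp only [h, K, this]
  have hβδ : ∀ n t, t ∉ locConst (β n) → δ t = β n t := by
    intro n t ht
    have : ∀ m, n ≤ m → β m t = β n t := by
      intro m hm
      induction m, hm using Nat.le_induction with
      | base => rfl
      | succ m hm ih =>
        rw [(hg m).eq_of_notMem t fun htm => ht (hmono m n hm htm), ih]
    exact tendsto_nhds_unique (hδ t) (tendsto_atTop_of_eventually_const this)
  have hlim : ∀ t, Tendsto (fun n => K n t) atTop (𝓝 (h t)) := fun t =>
    tendsto_const_nhds.add (hsg t).hasSum.tendsto_sum_nat
  refine ⟨h, ?_, ?_, ?_, ?_, ?_, ?_⟩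
  · refine hH.add (continuous_tsum (fun n => (hg n).continuous) hsum fun n t => ?_)
    rw [Real.norm_of_nonneg ((hg n).nonneg t)]
    exact hb n t
  · intro s t hc
    have : ∀ n, K n s = K n t := fun n => hKP n s t (hc.of_eqOn (hβ n) (hβδ n))
    exact tendsto_nhds_unique (hlim s) ((hlim t).congr fun n => (this n).symm)
  · intro s t hst hmin
    have : ∀ n, β n s = β n t := fun n =>
      have h1 := ((hKP n).min_of_le (hβ n) (hle n) (heq n) hst hmin).1
      hKQ n s t h1.1 h1.2
    exact tendsto_nhds_unique (hδ s) ((hδ t).congr fun n => (this n).symm)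
  · exact hK0 ▸ hle 0
  · exact hK0 ▸ heq 0
  · intro t ht
    have hz : ∀ n, g n t = 0 := by
      have : ∑' i, g i t = 0 := by
        simpa [h] using ht
      exact fun n => congrFun (((hsg t).hasSum_iff.2 this |> (hasSum_zero_iff_of_nonneg
        fun n => (hg n).nonneg t).1)) n
    have : ∀ n, β n t = β 0 t := by
      intro n
      induction n with
      | zero => rfl
      | succ n ih => rw [(hg n).eq_of_height_eq_zero (hβ n) (hO n) (hz n), ih]
    exact tendsto_nhds_unique (hδ t) (tendsto_const_nhds.congr fun n => (this n).symm)

theorem IsFolding.comp {Y : Type*} {β β' : I → Y} {g : I → ℝ} (hg : IsFolding β β' g) (e : I ≃ₜ I) :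
    IsFolding (β ∘ e) (β' ∘ e) (g ∘ e) where
  continuous := hg.continuous.comp e.continuous
  nonneg t := hg.nonneg _
  height_eq_zero t ht := hg.height_eq_zero _ (by rwa [locConst_comp] at ht)
  eq_of_notMem t ht := hg.eq_of_notMem _ (by rwa [locConst_comp] at ht)
  eq_of_height_eq s t hc h := hg.eq_of_height_eq _ _ (hc.of_comp e.continuous) h
  height_eq_of_constOn s t hc hc' :=
    hg.height_eq_of_constOn _ _ (hc.of_comp e.continuous) (hc'.of_comp e.continuous)

end Folding

/-! ### Foldings from Cantor-inverse-pair extensions -/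

section Extension

variable {X : Type*} [MetricSpace X]

/-- The truncated variation of `c` from `q` within `[q, max q t]`. -/
noncomputable def variationFrom (c : I → X) (q t : I) : ℝ :=
  sSup ((fun u : I => min 1 (dist (c q) (c (max q (min u t))))) '' univ)

theorem le_variationFrom (c : I → X) {q t p : I} (hq : q ≤ p) (ht : p ≤ t) :
    min 1 (dist (c q) (c p)) ≤ variationFrom c q t := by
  refine le_csSup ⟨1, ?_⟩ ⟨p, mem_univ _, ?_⟩
  · rintro _ ⟨u, -, rfl⟩
    exact min_le_left _ _
  · simp only [min_eq_left ht, max_eq_right hq]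

theorem variationFrom_le {c : I → X} {q t : I} {r : ℝ} (hr : 0 ≤ r)
    (h : ∀ p, q ≤ p → p ≤ t → min 1 (dist (c q) (c p)) ≤ r) : variationFrom c q t ≤ r := by
  refine csSup_le (univ_nonempty.image _) ?_
  rintro _ ⟨u, -, rfl⟩
  rcases le_total q (min u t) with hu | hu
  · simp only [max_eq_right hu]
    exact h _ hu (min_le_right _ _)
  · simp only [max_eq_left hu, dist_self]
    exact (min_le_right _ _).trans hr

theorem variationFrom_nonneg (c : I → X) (q t : I) : 0 ≤ variationFrom c q t := by
  refine Real.sSup_nonneg ?_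
  rintro _ ⟨u, -, rfl⟩
  exact le_min zero_le_one dist_nonneg

theorem variationFrom_le_one (c : I → X) (q t : I) : variationFrom c q t ≤ 1 :=
  variationFrom_le zero_le_one fun _ _ _ => min_le_left _ _

theorem variationFrom_eq_zero (c : I → X) {q t : I} (h : t ≤ q) : variationFrom c q t = 0 := by
  refine le_antisymm (variationFrom_le le_rfl fun p h1 h2 => ?_) (variationFrom_nonneg c q t)
  rw [le_antisymm (h2.trans h) h1, dist_self]
  exact min_le_right _ _

theorem variationFrom_mono (c : I → X) (q : I) : Monotone (variationFrom c q) :=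
  fun _ _ hst => variationFrom_le (variationFrom_nonneg _ _ _)
    fun _ h1 h2 => le_variationFrom c h1 (h2.trans hst)

theorem continuous_variationFrom {c : I → X} (hc : Continuous c) (q : I) :
    Continuous (variationFrom c q) := by
  unfold variationFrom
  refine isCompact_univ.continuous_sSup
    (f := fun (t u : I) => min 1 (dist (c q) (c (max q (min u t))))) ?_
  change Continuous fun p : I × I => _
  fun_prop

theorem ConstOn.variationFrom_eq {c : I → X} {s t : I} (h : ConstOn c s t) (q : I) :
    variationFrom c q s = variationFrom c q t := by
  wlog hst : s ≤ t generalizing s t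
  · exact (this h.symm (le_of_not_ge hst)).symm
  refine le_antisymm (variationFrom_mono c q hst) ?_
  refine variationFrom_le (variationFrom_nonneg _ _ _) fun p h1 h2 => ?_
  rcases le_total p s with hp | hp
  · exact le_variationFrom c h1 hp
  rcases le_total q s with hq | hq
  · rw [h p (Icc_subset_uIcc ⟨hp, h2⟩)]
    exact le_variationFrom c hq le_rfl
  · rw [h.eq (u := q) (v := p) (Icc_subset_uIcc ⟨hq, h1.trans h2⟩) (Icc_subset_uIcc ⟨hp, h2⟩),
      dist_self]
    exact (min_le_right _ _).trans (variationFrom_nonneg _ _ _)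

/-- Every path has a height function whose level sets are intervals of constancy. -/
theorem exists_injective_height {c : I → X} (hc : Continuous c) :
    ∃ κ : I → ℝ, Continuous κ ∧ (∀ t, 0 ≤ κ t) ∧ (∀ t, κ t ≤ 1) ∧ κ 0 = 0 ∧
      HeightConst κ c ∧ ∀ s t, κ s = κ t → c s = c t := by
  let q : ℕ → I := TopologicalSpace.denseSeq I
  let F : ℕ → I → ℝ := fun n t => 1 / 2 / 2 ^ n * variationFrom c (q n) t
  have hsum : HasSum (fun n : ℕ => (1 : ℝ) / 2 / 2 ^ n) 1 := hasSum_geometric_two' 1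
  have hF0 : ∀ n t, 0 ≤ F n t := fun n t =>
    mul_nonneg (by positivity) (variationFrom_nonneg _ _ _)
  have hF1 : ∀ n t, F n t ≤ 1 / 2 / 2 ^ n := fun n t =>
    mul_le_of_le_one_right (by positivity) (variationFrom_le_one _ _ _)
  have hFs : ∀ t, Summable fun n => F n t := fun t =>
    hsum.summable.of_nonneg_of_le (hF0 · t) (hF1 · t)
  have hFm : ∀ n, Monotone (F n) := fun n s t hst =>
    mul_le_mul_of_nonneg_left (variationFrom_mono c _ hst) (by positivity)
  refine ⟨fun t => ∑' n, F n t, ?_, fun t => tsum_nonneg (hF0 · t), fun t => ?_, ?_, ?_, ?_⟩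
  · refine continuous_tsum (fun n => (continuous_variationFrom hc _).const_mul _) hsum.summable
      fun n t => ?_
    rw [Real.norm_of_nonneg (hF0 n t)]
    exact hF1 n t
  · exact ((hFs t).tsum_le_tsum (hF1 · t) hsum.summable).trans hsum.tsum_eq.le
  · have : ∀ n, F n 0 = 0 := fun n => by
      simp only [F, variationFrom_eq_zero c (unitInterval.nonneg' (t := q n)), mul_zero]
    simp only [this, tsum_zero]
  · intro s t h
    simp only [F, h.variationFrom_eq]
  · intro s t hst
    wlog hlt : s < t generalizing s t
    · rcases (not_lt.1 hlt).eq_or_lt with h | h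
      · rw [h]
      · exact (this t s hst.symm h).symm
    have hF : ∀ n, F n s = F n t := by
      intro n
      refine (hFm n hlt.le).antisymm (not_lt.1 fun hn => ?_)
      exact hst.not_lt ((hFs s).tsum_lt_tsum (fun m => hFm m hlt.le) hn (hFs t))
    have hq : Ioo s t ∩ range q ⊆ {x | c x = c t} := by
      rintro _ ⟨hx, n, rfl⟩
      have h1 : variationFrom c (q n) t = 0 := by
        have := mul_left_cancel₀ (by positivity) (hF n)
        rw [← this, variationFrom_eq_zero c hx.1.le]
      have h2 := le_variationFrom c hx.2.le (le_refl t)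
      rw [h1] at h2
      rcases min_le_iff.1 h2 with h2 | h2
      · norm_num at h2
      · exact dist_le_zero.1 h2
    have h1 : Ioo s t ⊆ {x | c x = c t} :=
      ((TopologicalSpace.denseRange_denseSeq I).open_subset_closure_inter isOpen_Ioo).trans
        (closure_minimal hq (isClosed_eq hc continuous_const))
    have h2 := closure_minimal h1 (isClosed_eq hc continuous_const)
    rw [closure_Ioo hlt.ne] at h2
    exact h2 (left_mem_Icc.2 hlt.le)

theorem map_zero_of_monotone {φ : I → I} (h : Monotone φ) (hs : Function.Surjective φ) :
    φ 0 = 0 := by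
  obtain ⟨x, hx⟩ := hs 0
  exact le_antisymm ((h unitInterval.nonneg' : φ 0 ≤ φ x).trans hx.le) unitInterval.nonneg'

theorem map_one_of_monotone {φ : I → I} (h : Monotone φ) (hs : Function.Surjective φ) :
    φ 1 = 1 := by
  obtain ⟨x, hx⟩ := hs 1
  exact le_antisymm unitInterval.le_one' (hx.ge.trans (h unitInterval.le_one' : φ x ≤ φ 1))

/-- The piecewise linear map of `[0,1]` that goes up to `1` at `1/2` and back down. -/
noncomputable def tent (t : I) : I := projIcc (0 : ℝ) 1 zero_le_one (1 - |2 * (t : ℝ) - 1|)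

theorem continuous_tent : Continuous tent :=
  continuous_projIcc.comp (by fun_prop)

theorem tent_zero : tent 0 = 0 := by simp [tent]

theorem tent_one : tent 1 = 0 := by norm_num [tent]

theorem concatReverse_self {Y : Type*} (c : I → Y) : ConcatReverse c c = c ∘ tent := by
  funext t
  simp only [ConcatReverse, tent, Function.comp_apply]
  split_ifs with h
  · rw [abs_of_nonpos (by linarith)]; congr 2; ring
  · rw [abs_of_nonneg (by linarith)]; congr 2; ring

theorem continuous_of_concatReverse {c : I → X} (h : Continuous (ConcatReverse c c)) :
    Continuous c := by
  have hm : Continuous fun u : I => (⟨(u : ℝ) / 2, by linarith [u.2.1], by linarith [u.2.2]⟩ : I) :=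
    Continuous.subtype_mk (by fun_prop) _
  convert h.comp hm using 1
  funext u
  have hu : (u : ℝ) / 2 ≤ 1 / 2 := by linarith [u.2.2]
  simp only [ConcatReverse, Function.comp_apply, hu, if_true]
  rw [mul_div_cancel₀ _ two_ne_zero, projIcc_val]

/-- A CIP-loop on `[a,b]` has a height function supported on `(a,b)`. -/
theorem IsCIPLoop.exists_height {β : I → X} (hβ : Continuous β) {a b : I} (hab : a < b)
    (h : IsCIPLoop (restrictIcc β a b)) :
    ∃ k : I → ℝ, Continuous k ∧ (∀ t, 0 ≤ k t) ∧ (∀ t, k t ≤ 1) ∧ (∀ t, t ∉ Ioo a b → k t = 0) ∧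
      (∀ s ∈ Icc a b, ∀ t ∈ Icc a b, k s = k t → β s = β t) ∧
      ∀ s ∈ Icc a b, ∀ t ∈ Icc a b, ConstOn β s t → k s = k t := by
  obtain ⟨c, e, he, hec, -⟩ := h
  have hab' : (a : ℝ) < b := hab
  have hr : Continuous (restrictIcc β a b) :=
    hβ.comp (continuous_projIcc.comp (by fun_prop))
  have hc : Continuous c := continuous_of_concatReverse (hec ▸ hr.comp e.continuous)
  obtain ⟨κ, hκ, hκ0, hκ1, hκz, hκc, hκi⟩ := exists_injective_height hc
  let lin : I → I := fun u => projIcc (0 : ℝ) 1 zero_le_one (((u : ℝ) - a) / (b - a))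
  have hlin : Continuous lin := continuous_projIcc.comp (by fun_prop)
  let ψ : I → I := fun u => tent (e.symm (lin u))
  have hψ : Continuous ψ := continuous_tent.comp (e.symm.continuous.comp hlin)
  have he0 : e.symm 0 = 0 :=
    e.symm_apply_eq.2 (map_zero_of_monotone he.monotone e.surjective).symm
  have he1 : e.symm 1 = 1 :=
    e.symm_apply_eq.2 (map_one_of_monotone he.monotone e.surjective).symm
  have hβψ : ∀ u ∈ Icc a b, β u = c (ψ u) := by
    intro u hu
    have h1 : (a : ℝ) ≤ u := hu.1
    have h2 : (u : ℝ) ≤ b := hu.2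
    have hmem : ((u : ℝ) - a) / (b - a) ∈ Icc (0 : ℝ) 1 :=
      ⟨div_nonneg (by linarith) (by linarith), (div_le_one (by linarith)).2 (by linarith)⟩
    have h3 : restrictIcc β a b (lin u) = β u := by
      have : ((lin u : I) : ℝ) = ((u : ℝ) - a) / (b - a) := by
        simp only [lin, projIcc_of_mem _ hmem]
      simp only [restrictIcc, this]
      rw [mul_div_cancel₀ _ (by linarith), add_sub_cancel, projIcc_val]
    have h4 := congrFun hec (e.symm (lin u))
    rw [concatReverse_self, Function.comp_apply, e.apply_symm_apply, h3] at h4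
    exact h4
  have hψ0 : ∀ u, u ∉ Ioo a b → ψ u = 0 := by
    intro u hu
    by_cases h1 : a < u
    · have h2 : (b : ℝ) ≤ u := not_lt.1 fun h2 => hu ⟨h1, h2⟩
      have : lin u = 1 :=
        projIcc_of_right_le _ ((one_le_div (by linarith)).2 (by linarith))
      simp only [ψ, this, he1, tent_one]
    · have h2 : (u : ℝ) ≤ a := not_lt.1 h1
      have : lin u = 0 :=
        projIcc_of_le_left _ (div_nonpos_of_nonpos_of_nonneg (by linarith) (by linarith))
      simp only [ψ, this, he0, tent_zero]
  refine ⟨κ ∘ ψ, hκ.comp hψ, fun t => hκ0 _, fun t => hκ1 _, ?_, ?_, ?_⟩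
  · intro t ht
    rw [Function.comp_apply, hψ0 t ht, hκz]
  · intro s hs t ht hst
    rw [hβψ s hs, hβψ t ht]
    exact hκi _ _ hst
  · intro s hs t ht hst
    refine hκc _ _ (ConstOn.of_comp hψ fun u hu => ?_)
    have hu' : u ∈ Icc a b := ordConnected_Icc.uIcc_subset hs ht hu
    rw [Function.comp_apply, Function.comp_apply, ← hβψ u hu', ← hβψ s hs]
    exact hst u hu

theorem mem_Oset_iff {β : I → X} (x : I) : (x : ℝ) ∈ Oset β ↔ x ∈ locConst β := by
  constructor
  · rintro ⟨hx, U, hU, h⟩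
    exact mem_of_superset hU h
  · intro h
    exact ⟨x.2, _, h, fun s hs => hs⟩

theorem IsCantorPath.zero_notMem_locConst {β : I → X} (hβ : IsCantorPath β) :
    0 ∉ locConst β := fun h =>
  lt_irrefl _ (hβ.2.2.2.1 ((mem_Oset_iff 0).2 h)).1

theorem IsCantorPath.one_notMem_locConst {β : I → X} (hβ : IsCantorPath β) :
    1 ∉ locConst β := fun h =>
  lt_irrefl _ (hβ.2.2.2.1 ((mem_Oset_iff 1).2 h)).2

/-- A component of the locally constant set is an open interval that absorbs every interval of
constancy whose interior it meets. -/
theorem exists_component_endpoints {β : I → X} (hβ : IsCantorPath β) {x : ℝ} (hx : x ∈ Oset β) :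
    ∃ a b : I, a < b ∧ sInf (connectedComponentIn (Oset β) x) = a ∧
      sSup (connectedComponentIn (Oset β) x) = b ∧
      connectedComponentIn (Oset β) x = Ioo (a : ℝ) b ∧
      ∀ s t y, ConstOn β s t → y ∈ Ioo s t → y ∈ Ioo a b → a ≤ s ∧ t ≤ b := by
  set J := connectedComponentIn (Oset β) x with hJ
  have hopen : IsOpen J := hβ.2.2.1.connectedComponentIn
  have hsub : J ⊆ Oset β := connectedComponentIn_subset _ _
  have hconn : IsConnected J := isConnected_connectedComponentIn_iff.2 hx
  have h01 : J ⊆ Icc 0 1 := (hsub.trans hβ.2.2.2.1).trans Ioo_subset_Icc_self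
  have hbb : BddBelow J := bddBelow_Icc.mono h01
  have hba : BddAbove J := bddAbove_Icc.mono h01
  have hJeq : J = Ioo (sInf J) (sSup J) := by
    refine Subset.antisymm ?_ (hconn.Ioo_csInf_csSup_subset hbb hba)
    rw [← interior_Icc]
    exact interior_maximal (subset_Icc_csInf_csSup hbb hba) hopen
  have hlt : sInf J < sSup J := by
    have := hconn.nonempty
    rw [hJeq] at this
    exact nonempty_Ioo.1 this
  have hcl : closure J ⊆ Icc 0 1 := closure_minimal h01 isClosed_Icc
  refine ⟨⟨sInf J, hcl (csInf_mem_closure hconn.nonempty hbb)⟩,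
    ⟨sSup J, hcl (csSup_mem_closure hconn.nonempty hba)⟩, hlt, rfl, rfl, hJeq, ?_⟩
  intro s t y hst hy hyJ
  have hst' : s < t := hy.1.trans hy.2
  have hO : Ioo (s : ℝ) t ⊆ Oset β := by
    intro z hz
    have hz01 : z ∈ Icc (0 : ℝ) 1 := ⟨s.2.1.trans hz.1.le, hz.2.le.trans t.2.2⟩
    refine (mem_Oset_iff ⟨z, hz01⟩).2 ?_
    filter_upwards [Ioo_mem_nhds (a := s) (b := t) (x := ⟨z, hz01⟩) hz.1 hz.2] with w hw
    exact hst.eq (Icc_subset_uIcc ⟨hw.1.le, hw.2.le⟩) (Icc_subset_uIcc ⟨hz.1.le, hz.2.le⟩)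
  have hyJ' : (y : ℝ) ∈ J := by
    rw [hJeq]
    exact hyJ
  have h1 : Ioo (s : ℝ) t ⊆ J := by
    rw [hJ, connectedComponentIn_eq hyJ']
    exact isPreconnected_Ioo.subset_connectedComponentIn hy hO
  rw [hJeq] at h1
  exact (Ioo_subset_Ioo_iff (show (s : ℝ) < t from hst')).1 h1

/-- A `⪯*`-extension is a folding, with arbitrarily small height function. -/
theorem PrecExt.exists_isFolding {β β' : I → X} (hβ : IsCantorPath β) (hβ' : Continuous β')
    (h : PrecExt β β') {ε : ℝ} (hε : 0 < ε) :
    ∃ g : I → ℝ, IsFolding β β' g ∧ ∀ t, g t ≤ ε := by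
  obtain ⟨𝒰, hcomp, hout, hcip⟩ := h
  have hends : ∀ J : 𝒰, ∃ a b : I, a < b ∧ sInf J.1 = a ∧ sSup J.1 = b ∧
      J.1 = Ioo (a : ℝ) b ∧
      ∀ s t y, ConstOn β s t → y ∈ Ioo s t → y ∈ Ioo a b → a ≤ s ∧ t ≤ b := by
    rintro ⟨J, hJ⟩
    obtain ⟨x, hx, rfl⟩ := hcomp J hJ
    exact exists_component_endpoints hβ hx
  choose a b hab hinf hsup hJ habs using hends
  have hk : ∀ J : 𝒰, _ := fun J =>
    IsCIPLoop.exists_height hβ' (hab J) (hinf J ▸ hsup J ▸ hcip J.1 J.2)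
  choose k hkc hk0 hk1 hkz hkeq hkconst using hk
  have hdisj : ∀ J J' : 𝒰, ∀ y : ℝ, y ∈ J.1 → y ∈ J'.1 → J = J' := by
    rintro ⟨J, hJ⟩ ⟨J', hJ'⟩ y hy hy'
    obtain ⟨x, -, rfl⟩ := hcomp J hJ
    obtain ⟨x', -, rfl⟩ := hcomp J' hJ'
    exact Subtype.ext ((connectedComponentIn_eq hy).trans (connectedComponentIn_eq hy').symm)
  have hmem : ∀ (J : 𝒰) (t : I), (t : ℝ) ∈ J.1 ↔ t ∈ Ioo (a J) (b J) := by
    intro J t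
    rw [hJ J]
    rfl
  have hcount : 𝒰.Countable := by
    refine PairwiseDisjoint.countable_of_isOpen (s := id) ?_ ?_ ?_
    · intro J hJ J' hJ' hne
      refine Set.disjoint_left.2 fun y hy hy' => hne ?_
      exact congrArg Subtype.val (hdisj ⟨J, hJ⟩ ⟨J', hJ'⟩ y hy hy')
    · intro J hJ'
      change IsOpen J
      rw [show J = Ioo _ _ from hJ ⟨J, hJ'⟩]
      exact isOpen_Ioo
    · intro J hJ'
      change J.Nonempty
      rw [show J = Ioo _ _ from hJ ⟨J, hJ'⟩]
      exact nonempty_Ioo.2 (hab ⟨J, hJ'⟩)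
  have := hcount.to_subtype
  have := Encodable.ofCountable 𝒰
  obtain ⟨w, hw, C, hC, hCε⟩ := posSumOfEncodable hε 𝒰
  let g : I → ℝ := fun t => ∑' J, w J * k J t
  have hterm0 : ∀ J t, 0 ≤ w J * k J t := fun J t => mul_nonneg (hw J).le (hk0 J t)
  have hterm1 : ∀ J t, w J * k J t ≤ w J := fun J t =>
    mul_le_of_le_one_right (hw J).le (hk1 J t)
  have hval : ∀ J, ∀ t ∈ Icc (a J) (b J), g t = w J * k J t := by
    intro J t ht
    refine tsum_eq_single J fun J' hJ' => ?_
    rw [hkz J', mul_zero]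
    intro ht'
    rw [← closure_Ioo (hab J).ne] at ht
    obtain ⟨y, hy', hy⟩ := mem_closure_iff.1 ht _ isOpen_Ioo ht'
    exact hJ' (hdisj J' J y ((hmem J' y).2 hy') ((hmem J y).2 hy))
  have hzero : ∀ t, (∀ J, t ∉ Ioo (a J) (b J)) → g t = 0 ∧ β' t = β t := by
    intro t ht
    constructor
    · change ∑' J, w J * k J t = 0
      simp only [hkz _ t (ht _), mul_zero, tsum_zero]
    · refine hout t ?_
      rintro ⟨J, hJ, htJ⟩
      exact ht ⟨J, hJ⟩ ((hmem ⟨J, hJ⟩ t).1 htJ)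
  have hoff : ∀ t, t ∉ locConst β → ∀ J, t ∉ Ioo (a J) (b J) := by
    intro t ht J htJ
    rw [← hmem] at htJ
    obtain ⟨x, -, hx⟩ := hcomp J.1 J.2
    rw [hx] at htJ
    exact ht ((mem_Oset_iff t).1 (connectedComponentIn_subset _ _ htJ))
  have hcases : ∀ s t, s < t → ConstOn β s t →
      (∃ J, s ∈ Icc (a J) (b J) ∧ t ∈ Icc (a J) (b J)) ∨
      (∀ J, s ∉ Ioo (a J) (b J)) ∧ ∀ J, t ∉ Ioo (a J) (b J) := by
    intro s t hst hc
    by_cases hJ : ∃ J y, y ∈ Ioo s t ∧ y ∈ Ioo (a J) (b J)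
    · obtain ⟨J, y, hy, hyJ⟩ := hJ
      obtain ⟨h1, h2⟩ := habs J s t y hc hy hyJ
      exact Or.inl ⟨J, ⟨h1, hst.le.trans h2⟩, ⟨h1.trans hst.le, h2⟩⟩
    · push Not at hJ
      refine Or.inr ⟨fun J hs => ?_, fun J ht => ?_⟩
      · obtain ⟨y, hy1, hy2⟩ := exists_between (lt_min hst hs.2)
        exact hJ J y ⟨hy1, hy2.trans_le (min_le_left _ _)⟩
          ⟨hs.1.trans hy1, hy2.trans_le (min_le_right _ _)⟩
      · obtain ⟨y, hy1, hy2⟩ := exists_between (max_lt hst ht.1)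
        exact hJ J y ⟨(le_max_left _ _).trans_lt hy1, hy2⟩
          ⟨(le_max_right _ _).trans_lt hy1, hy2.trans ht.2⟩
  have hsymm : ∀ {p : I → I → Prop}, (∀ s, p s s) → (∀ s t, p s t → p t s) →
      (∀ s t, s < t → p s t) → ∀ s t, p s t := by
    intro p hr hs hl s t
    rcases lt_trichotomy s t with h | h | h
    · exact hl s t h
    · exact h ▸ hr s
    · exact hs t s (hl t s h)
  refine ⟨g, ⟨?_, fun t => tsum_nonneg (hterm0 · t), fun t ht => (hzero t (hoff t ht)).1,
    fun t ht => (hzero t (hoff t ht)).2, ?_, ?_⟩, fun t => ?_⟩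
  · refine continuous_tsum (fun J => (hkc J).const_mul _) hC.summable fun J t => ?_
    rw [Real.norm_of_nonneg (hterm0 J t)]
    exact hterm1 J t
  · refine hsymm (fun _ _ _ => rfl) (fun s t h hc hg => (h hc.symm hg.symm).symm) ?_
    intro s t hst hc hg
    rcases hcases s t hst hc with ⟨J, hs, ht⟩ | ⟨hs, ht⟩
    · rw [hval J s hs, hval J t ht] at hg
      exact hkeq J s hs t ht (mul_left_cancel₀ (hw J).ne' hg)
    · rw [(hzero s hs).2, (hzero t ht).2, hc t right_mem_uIcc]
  · refine hsymm (fun _ _ _ => rfl) (fun s t h hc hc' => (h hc.symm hc'.symm).symm) ?_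
    intro s t hst hc hc'
    rcases hcases s t hst hc with ⟨J, hs, ht⟩ | ⟨hs, ht⟩
    · rw [hval J s hs, hval J t ht, hkconst J s hs t ht hc']
    · rw [(hzero s hs).1, (hzero t ht).1]
  · exact ((hC.summable.of_nonneg_of_le (hterm0 · t) (hterm1 · t)).tsum_le_tsum (hterm1 · t)
      hC.summable).trans (hC.tsum_eq.le.trans hCε)

end Extension

/-! ### The alternating lemma -/

section Concatenation

variable {Y : Type*}

/-- The parameter of the first path at time `t` of a concatenation. -/
noncomputable def firstParam (t : I) : I := projIcc (0 : ℝ) 1 zero_le_one (2 * (t : ℝ))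

/-- The parameter of the reversed second path at time `t` of a concatenation. -/
noncomputable def secondParam (t : I) : I := projIcc (0 : ℝ) 1 zero_le_one (2 - 2 * (t : ℝ))

/-- The midpoint of `[0,1]`. -/
noncomputable def midpointI : I := ⟨1 / 2, by norm_num, by norm_num⟩

theorem continuous_firstParam : Continuous firstParam :=
  continuous_projIcc.comp (by fun_prop)

theorem continuous_secondParam : Continuous secondParam :=
  continuous_projIcc.comp (by fun_prop)

theorem firstParam_midpointI : firstParam midpointI = 1 :=
  projIcc_of_right_le _ (by norm_num [midpointI])

theorem secondParam_midpointI : secondParam midpointI = 1 :=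
  projIcc_of_right_le _ (by norm_num [midpointI])

theorem concatReverse_of_le (α β : I → Y) {t : I} (ht : t ≤ midpointI) :
    ConcatReverse α β t = α (firstParam t) :=
  if_pos (show (t : ℝ) ≤ 1 / 2 from ht)

theorem concatReverse_of_ge {α β : I → Y} (h : α 1 = β 1) {t : I} (ht : midpointI ≤ t) :
    ConcatReverse α β t = β (secondParam t) := by
  rcases ht.eq_or_lt with rfl | ht
  · rw [concatReverse_of_le α β le_rfl, firstParam_midpointI, secondParam_midpointI, h]
  · exact if_neg (show ¬ (t : ℝ) ≤ 1 / 2 from ht.not_ge)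

theorem continuous_concatReverse [TopologicalSpace Y] {α β : I → Y}
    (hα : Continuous α) (hβ : Continuous β) (h : α 1 = β 1) :
    Continuous (ConcatReverse α β) := by
  refine Continuous.if_le (hα.comp continuous_firstParam) (hβ.comp continuous_secondParam)
    (by fun_prop) continuous_const fun t ht => ?_
  obtain rfl : t = midpointI := Subtype.ext ht
  change α (firstParam midpointI) = β (secondParam midpointI)
  rw [firstParam_midpointI, secondParam_midpointI, h]

theorem concatReverse_zero (α β : I → Y) : ConcatReverse α β 0 = α 0 := by
  simp [ConcatReverse]

theorem concatReverse_one (α β : I → Y) : ConcatReverse α β 1 = β 0 := by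
  norm_num [ConcatReverse]

end Concatenation

section Alternating

variable {X : Type*} [MetricSpace X]

/-- Two paths are ℝ-tree homotopic as soon as they have height functions compatible with them and
with each other. -/
theorem rTreeHomotopic_of_heights {α γ : I → X} (hα : Continuous α) (hγ : Continuous γ)
    (hα0 : α 0 = γ 0) (hα1 : α 1 = γ 1) {H h : I → ℝ} (hH : Continuous H) (hh : Continuous h)
    (hH0 : H 0 = 0) (hh0 : h 0 = 0) (h1 : H 1 = h 1) (hHnn : ∀ t, 0 ≤ H t)
    (hhnn : ∀ t, 0 ≤ h t) (hHα : HeightCompat H α) (hhγ : HeightCompat h γ)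
    (hmixed : ∀ u v, H u = h v → (∀ w, v ≤ w → h v ≤ h w) → α u = γ v) :
    RTreeHomotopic α γ := by
  refine ⟨hα0, hα1, factors_through_rTree ⟨ConcatReverse H h, continuous_concatReverse hH hh h1⟩
    (continuous_concatReverse hα hγ hα1) ?_ ?_ ?_⟩
  · change ConcatReverse H h 0 = ConcatReverse H h 1
    rw [concatReverse_zero, concatReverse_one, hH0, hh0]
  · intro u
    change ConcatReverse H h 0 ≤ ConcatReverse H h u
    rw [concatReverse_zero, hH0]
    unfold ConcatReverse
    split_ifs
    · exact hHnn _
    · exact hhnn _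
  · intro s t hst hmin
    change ConcatReverse H h s = ConcatReverse H h t at hst
    change ∀ u ∈ uIcc s t, ConcatReverse H h s ≤ ConcatReverse H h u at hmin
    wlog hle : s ≤ t generalizing s t
    · refine (this t s hst.symm (fun u hu => ?_) (le_of_not_ge hle)).symm
      rw [← hst]
      exact hmin u (uIcc_comm t s ▸ hu)
    rcases le_total t midpointI with ht | ht
    · have hs := hle.trans ht
      rw [concatReverse_of_le _ _ hs, concatReverse_of_le _ _ ht]
      rw [concatReverse_of_le _ _ hs, concatReverse_of_le _ _ ht] at hst
      refine hHα _ _ hst fun w hw => ?_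
      obtain ⟨u, hu, rfl⟩ := intermediate_value_uIcc continuous_firstParam.continuousOn hw
      have h2 := hmin u hu
      rw [uIcc_of_le hle] at hu
      rwa [concatReverse_of_le _ _ hs, concatReverse_of_le _ _ (hu.2.trans ht)] at h2
    rcases le_total midpointI s with hs | hs
    · rw [concatReverse_of_ge hα1 hs, concatReverse_of_ge hα1 ht]
      rw [concatReverse_of_ge h1 hs, concatReverse_of_ge h1 ht] at hst
      refine hhγ _ _ hst fun w hw => ?_
      obtain ⟨u, hu, rfl⟩ := intermediate_value_uIcc continuous_secondParam.continuousOn hw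
      have h2 := hmin u hu
      rw [uIcc_of_le hle] at hu
      rwa [concatReverse_of_ge h1 hs, concatReverse_of_ge h1 (hs.trans hu.1)] at h2
    · rw [concatReverse_of_le _ _ hs, concatReverse_of_ge hα1 ht]
      rw [hst] at hmin
      rw [concatReverse_of_le _ _ hs, concatReverse_of_ge h1 ht] at hst
      refine hmixed _ _ hst fun w hw => ?_
      have hw' : w ∈ uIcc (secondParam midpointI) (secondParam t) := by
        rw [secondParam_midpointI]
        exact Icc_subset_uIcc' ⟨hw, unitInterval.le_one'⟩
      obtain ⟨u, hu, rfl⟩ := intermediate_value_uIcc continuous_secondParam.continuousOn hw'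
      rw [uIcc_of_le ht] at hu
      have h2 := hmin u (Icc_subset_uIcc ⟨hs.trans hu.1, hu.2⟩)
      rwa [concatReverse_of_ge h1 ht, concatReverse_of_ge h1 hu.1] at h2

/-- Successive compositions of self-homeomorphisms of `[0,1]` that are geometrically close to the
identity converge uniformly to a monotone surjection. -/
theorem exists_limit_of_homeomorphs (e : ℕ → I ≃ₜ I) (he : ∀ n, Monotone (e n)) {C r : ℝ}
    (hr1 : r < 1) (hd : ∀ n t, dist (e n t) (e (n + 1) t) ≤ C * r ^ n) (hr0 : 0 ≤ r) :
    ∃ φ : I → I, Continuous φ ∧ Monotone φ ∧ Function.Surjective φ ∧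
      ∀ t, Tendsto (fun n => e n t) atTop (𝓝 (φ t)) := by
  have hlim : ∀ t, ∃ x, Tendsto (fun n => e n t) atTop (𝓝 x) := fun t =>
    cauchySeq_tendsto_of_complete (cauchySeq_of_le_geometric r C hr1 (hd · t))
  choose φ hφ using hlim
  have hunif : TendstoUniformly (fun n t => e n t) φ atTop := by
    rw [Metric.tendstoUniformly_iff]
    intro ε hε
    have h0 : Tendsto (fun n : ℕ => C * r ^ n / (1 - r)) atTop (𝓝 0) := by
      have := ((tendsto_pow_atTop_nhds_zero_of_lt_one hr0 hr1).const_mul C).div_const (1 - r)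
      simpa using this
    filter_upwards [h0.eventually (gt_mem_nhds hε)] with n hn t
    rw [dist_comm]
    exact (dist_le_of_le_geometric_of_tendsto r C hr1 (hd · t) (hφ t) n).trans_lt hn
  have hcont : Continuous φ :=
    hunif.continuous (Eventually.of_forall fun n => (e n).continuous).frequently
  refine ⟨φ, hcont, fun s t hst => le_of_tendsto_of_tendsto' (hφ s) (hφ t) fun n => he n hst,
    fun y => ?_, hφ⟩
  have h0 : φ 0 = 0 := tendsto_nhds_unique (hφ 0) <| tendsto_const_nhds.congr fun n =>
    (map_zero_of_monotone (he n) (e n).surjective).symm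
  have h1 : φ 1 = 1 := tendsto_nhds_unique (hφ 1) <| tendsto_const_nhds.congr fun n =>
    (map_one_of_monotone (he n) (e n).surjective).symm
  have hy : y ∈ uIcc (φ 0) (φ 1) := by
    rw [h0, h1]
    exact Icc_subset_uIcc ⟨unitInterval.nonneg', unitInterval.le_one'⟩
  obtain ⟨x, -, hx⟩ := intermediate_value_uIcc hcont.continuousOn hy
  exact ⟨x, hx⟩

/-- A height function for `γ ∘ φ`, with `φ` a monotone surjection, descends to one for `γ`. -/
theorem exists_height_of_comp {Y : Type*} {γ : I → Y} {φ : I → I} (hφ : Continuous φ) (hφm : Monotone φ)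
    (hφs : Function.Surjective φ) {h : I → ℝ} (hh : Continuous h)
    (hconst : HeightConst h (γ ∘ φ)) (hcompat : HeightCompat h (γ ∘ φ)) :
    ∃ k : I → ℝ, Continuous k ∧ HeightCompat k γ ∧ ∀ t, k (φ t) = h t := by
  have hs := Function.surjInv_eq hφs
  have hk : ∀ t, h (Function.surjInv hφs (φ t)) = h t := by
    intro t
    refine hconst _ _ (ConstOn.comp hφm ?_)
    rw [hs]
    intro u hu
    rw [uIcc_self] at hu
    rw [hu]
  refine ⟨h ∘ Function.surjInv hφs, ?_, ?_, hk⟩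
  · rw [(hφ.isClosedMap.isQuotientMap hφ hφs).continuous_iff]
    exact hh.congr fun t => (hk t).symm
  · intro s t hst hmin
    have := hcompat (Function.surjInv hφs s) (Function.surjInv hφs t) hst fun u hu => by
      have h1 := hmin (φ u) (by
        have := hφm.mapsTo_uIcc hu
        rwa [hs, hs] at this)
      simpa only [Function.comp_apply, hk] using h1
    simpa only [Function.comp_apply, hs] using this

theorem rTreeHomotopic_zero_of_alternating {α α' : ℕ → I → X} {γ : I → X} {f : ℕ → I ≃ₜ I}
    (hα : ∀ n, IsCantorPath (α n)) (hα' : ∀ n, IsCantorPath (α' n)) (hγ : Continuous γ)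
    (hmono : ∀ n, StrictMono (f n)) (hlim : TendstoUniformly α γ atTop)
    (hext : ∀ n, PrecExt (α n) (α' n)) (hcomp : ∀ n, α (n + 1) = α' n ∘ f n) {C r : ℝ}
    (hr0 : 0 ≤ r) (hr1 : r < 1) (hf : ∀ n t, |(f n t : ℝ) - t| ≤ C * r ^ n) :
    RTreeHomotopic (α 0) γ := by
  let e : ℕ → I ≃ₜ I := fun n =>
    Nat.rec (Homeomorph.refl I) (fun m em => em.trans (f m).symm) n
  have he : ∀ n, Monotone (e n) := by
    intro n
    induction n with
    | zero => exact monotone_id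
    | succ n ih =>
      intro s t hst
      refine (hmono n).le_iff_le.1 ?_
      change f n ((f n).symm (e n s)) ≤ f n ((f n).symm (e n t))
      rw [(f n).apply_symm_apply, (f n).apply_symm_apply]
      exact ih hst
  have hd : ∀ n t, dist (e n t) (e (n + 1) t) ≤ C * r ^ n := by
    intro n t
    have := hf n (e (n + 1) t)
    have h2 : f n (e (n + 1) t) = e n t := (f n).apply_symm_apply _
    rw [h2] at this
    exact this
  obtain ⟨φ, hφ, hφm, hφs, hφlim⟩ := exists_limit_of_homeomorphs e he hr1 hd hr0
  have hfold := fun n => (hext n).exists_isFolding (hα n) (hα' n).1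
    (ε := (1 / 2 : ℝ) ^ n) (by positivity)
  choose g hg hgb using hfold
  have hβ : ∀ n, Continuous (α n ∘ e n) := fun n => (hα n).1.comp (e n).continuous
  have hβ' : ∀ n, α (n + 1) ∘ e (n + 1) = α' n ∘ e n := by
    intro n
    funext t
    rw [hcomp]
    exact congrArg (α' n) ((f n).apply_symm_apply _)
  have hδ : ∀ t, Tendsto (fun n => (α n ∘ e n) t) atTop (𝓝 ((γ ∘ φ) t)) := fun t =>
    hlim.tendsto_comp hγ.continuousAt (hφlim t)
  obtain ⟨H, hH, hH0, -, hHz, hHconst, hHinj⟩ := exists_injective_height (hα 0).1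
  have h0 := (hα 0).zero_notMem_locConst
  have h1 := (hα 0).one_notMem_locConst
  obtain ⟨h, hh, hhconst, hhcompat, hHh, hhH, hδ0⟩ :=
    exists_height_of_foldings (β := fun n => α n ∘ e n) (g := fun n => g n ∘ e n) hβ
      (fun n => by simpa only [hβ'] using (hg n).comp (e n)) (fun n t => hgb n _) hδ h0 hH
      hHconst (fun s t hst _ => hHinj s t hst)
  obtain ⟨k, hk, hkγ, hkφ⟩ := exists_height_of_comp hφ hφm hφs hh hhconst hhcompat
  have hφ0 := map_zero_of_monotone hφm hφs
  have hφ1 := map_one_of_monotone hφm hφs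
  have hγ0 : ∀ t, t ∉ locConst (α 0) → γ (φ t) = α 0 t := fun t ht => hδ0 t (hhH t ht)
  have hk0 : ∀ t, t ∉ locConst (α 0) → k (φ t) = H t := fun t ht => (hkφ t).trans (hhH t ht)
  refine rTreeHomotopic_of_heights (hα 0).1 hγ ?_ ?_ hH hk hHz ?_ ?_ hH0 ?_
    (fun s t hst _ => hHinj s t hst) hkγ ?_
  · rw [← hγ0 0 h0, hφ0]
  · rw [← hγ0 1 h1, hφ1]
  · rw [← hφ0, hk0 0 h0, hHz]
  · rw [← hk0 1 h1, hφ1]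
  · intro t
    obtain ⟨t, rfl⟩ := hφs t
    rw [hkφ]
    exact (hH0 t).trans (hHh t)
  · intro u v huv hmin
    obtain ⟨v, rfl⟩ := hφs v
    obtain ⟨w, hw, hwO, hvw⟩ : ∃ w, v ≤ w ∧ w ∉ locConst (α 0) ∧ ConstOn (α 0) v w := by
      rcases constOn_or_exists_left (hα 0).1 v 1 with hc | ⟨w, hw, hwO, hc⟩
      · exact ⟨1, unitInterval.le_one', h1, hc⟩
      · rw [uIcc_of_le unitInterval.le_one'] at hw
        exact ⟨w, hw.1, hwO, hc⟩
    have h2 : h v = H v := by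
      refine le_antisymm ?_ (hHh v)
      rw [hHconst v w hvw, ← hhH w hwO, ← hkφ, ← hkφ]
      exact hmin _ (hφm hw)
    rw [show γ (φ v) = α 0 v from hδ0 v h2]
    exact hHinj u v (by rw [huv, hkφ, h2])

end Alternating

/-- The alternating lemma: an alternating sequence of `⪯*`-extensions and small
reparameterizations converging uniformly to `γ` gives `αₙ ≃ᵣ γ` for all `n`. -/
theorem alternating_lemma {X : Type*} [MetricSpace X]
    (α α' : ℕ → unitInterval → X) (γ : unitInterval → X)
    (f : ℕ → (unitInterval ≃ₜ unitInterval))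
    (hα : ∀ n, IsCantorPath (α n)) (hα' : ∀ n, IsCantorPath (α' n))
    (hγ : Continuous γ)
    (hmono : ∀ n, StrictMono (⇑(f n)))
    (h1 : TendstoUniformly (fun n => α n) γ Filter.atTop)
    (h2 : ∀ n, PrecExt (α n) (α' n))
    (h3 : ∀ n, α (n + 1) = α' n ∘ ⇑(f n))
    (h4 : ∃ a r : ℝ, 0 < a ∧ 0 ≤ r ∧ r < 1 ∧
      ∀ n, (⨆ t : unitInterval, |(((f n) t : ℝ)) - (t : ℝ)|) ≤ a * r ^ n) :
    ∀ n, RTreeHomotopic (α n) γ := by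
  obtain ⟨a, r, -, hr0, hr1, hf⟩ := h4
  intro N
  have hbound : ∀ n t, |(f n t : ℝ) - t| ≤ a * r ^ n := by
    intro n t
    refine (le_ciSup (f := fun t : unitInterval => |(f n t : ℝ) - t|) ⟨1, ?_⟩ t).trans (hf n)
    rintro _ ⟨t, rfl⟩
    exact abs_sub_le_of_le_of_le (f n t).2.1 (f n t).2.2 t.2.1 t.2.2 |>.trans (by norm_num)
  have := rTreeHomotopic_zero_of_alternating (α := fun n => α (n + N))
    (α' := fun n => α' (n + N)) (f := fun n => f (n + N)) (fun n => hα _) (fun n => hα' _) hγ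
    (fun n => hmono _) (fun u hu => (tendsto_add_atTop_nat N).eventually (h1 u hu))
    (fun n => h2 _) (fun n => by rw [← h3, Nat.add_right_comm]) (C := a * r ^ N) hr0 hr1
    (fun n t => by rw [mul_assoc, ← pow_add, Nat.add_comm N]; exact hbound _ t)
  rwa [Nat.zero_add] at this
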